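/- Let u, v, w, z : ℝ × ℝ → ℝ be smooth functions of (x,t) solving the generalized Riemann equation at N=4, i.e. u_t = 2u·u_x − 2v, v_t = 2u·v_x − 2w, w_t = 2u·w_x − 2z, z_t = 2u·z_x, with z_x nowhere zero and z nowhere zero. Fix n ≥ 1 and let G : ℝ^{4n+3} → ℝ be any smooth function. Then the function F = z_x·G(z, w² − 2v·z, (3u·z² − 3v·w·z + w³)·z^{−2}, α₁, β₁, γ₁, δ₁ − w·z^{−1}, α₂, β₂, γ₂, δ₂, …, α_n, β_n, γ_n, δ_n) satisfies the conservation law ∂_t F = ∂_x(2u·F) at every point. -/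

import Mathlib

/-- Partial derivative with respect to the first variable `x`. -/
noncomputable def pdx (f : ℝ × ℝ → ℝ) (p : ℝ × ℝ) : ℝ := deriv (fun x => f (x, p.2)) p.1

/-- Partial derivative with respect to the second variable `t`. -/
noncomputable def pdt (f : ℝ × ℝ → ℝ) (p : ℝ × ℝ) : ℝ := deriv (fun t => f (p.1, t)) p.2

open scoped ContDiff

lemma pdx_eq_fderiv {f : ℝ × ℝ → ℝ} {p : ℝ × ℝ} (hf : DifferentiableAt ℝ f p) :
    pdx f p = fderiv ℝ f p (1, 0) := by
  have h : HasDerivAt (fun x : ℝ => (x, p.2)) ((1 : ℝ), (0 : ℝ)) p.1 :=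
    (hasDerivAt_id p.1).prodMk (hasDerivAt_const p.1 p.2)
  exact (HasFDerivAt.comp_hasDerivAt p.1 (f := fun x : ℝ => (x, p.2)) hf.hasFDerivAt h).deriv

lemma pdt_eq_fderiv {f : ℝ × ℝ → ℝ} {p : ℝ × ℝ} (hf : DifferentiableAt ℝ f p) :
    pdt f p = fderiv ℝ f p (0, 1) := by
  have h : HasDerivAt (fun t : ℝ => (p.1, t)) ((0 : ℝ), (1 : ℝ)) p.2 :=
    (hasDerivAt_const p.2 p.1).prodMk (hasDerivAt_id p.2)
  exact (HasFDerivAt.comp_hasDerivAt p.2 (f := fun t : ℝ => (p.1, t)) hf.hasFDerivAt h).deriv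

lemma pdx_eq_fderiv_fun {f : ℝ × ℝ → ℝ} (hf : ContDiff ℝ ∞ f) :
    pdx f = fun p => fderiv ℝ f p (1, 0) :=
  funext fun p => pdx_eq_fderiv (hf.differentiable (by simp) p)

lemma pdt_eq_fderiv_fun {f : ℝ × ℝ → ℝ} (hf : ContDiff ℝ ∞ f) :
    pdt f = fun p => fderiv ℝ f p (0, 1) :=
  funext fun p => pdt_eq_fderiv (hf.differentiable (by simp) p)

lemma ContDiff.pdx {f : ℝ × ℝ → ℝ} (hf : ContDiff ℝ ∞ f) : ContDiff ℝ ∞ (pdx f) := by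
  rw [pdx_eq_fderiv_fun hf]
  exact (hf.fderiv_right (m := ∞) (by simp)).clm_apply contDiff_const

lemma ContDiff.pdt {f : ℝ × ℝ → ℝ} (hf : ContDiff ℝ ∞ f) : ContDiff ℝ ∞ (pdt f) := by
  rw [pdt_eq_fderiv_fun hf]
  exact (hf.fderiv_right (m := ∞) (by simp)).clm_apply contDiff_const

lemma pdt_pdx_comm {f : ℝ × ℝ → ℝ} (hf : ContDiff ℝ ∞ f) (p : ℝ × ℝ) :
    pdt (pdx f) p = pdx (pdt f) p := by
  have hd : DifferentiableAt ℝ (fderiv ℝ f) p :=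
    (hf.fderiv_right (m := ∞) (by simp)).differentiable (by simp) p
  rw [pdt_eq_fderiv (hf.pdx.differentiable (by simp) p),
    pdx_eq_fderiv (hf.pdt.differentiable (by simp) p),
    pdx_eq_fderiv_fun hf, pdt_eq_fderiv_fun hf,
    fderiv_clm_apply hd (differentiableAt_const _), fderiv_clm_apply hd (differentiableAt_const _)]
  have hs : IsSymmSndFDerivAt ℝ f p := hf.contDiffAt.isSymmSndFDerivAt (by
    rw [minSmoothness_of_isRCLikeNormedField]
    exact WithTop.coe_le_coe.2 (le_top : (2 : ℕ∞) ≤ ⊤))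
  simpa using hs (0, 1) (1, 0)

lemma hasDerivAt_fst_slice {f : ℝ × ℝ → ℝ} (hf : ContDiff ℝ ∞ f) (p : ℝ × ℝ) :
    HasDerivAt (fun x => f (x, p.2)) (pdx f p) p.1 := by
  have h : DifferentiableAt ℝ (fun x => f (x, p.2)) p.1 :=
    ((hf.differentiable (by simp)).comp
      (differentiable_id.prodMk (differentiable_const p.2))) p.1
  exact h.hasDerivAt

/-- `f` is smooth and its derivative along the vector field `∂_t - 2u ∂_x` is `g`. -/
def HasMaterialDeriv (u f g : ℝ × ℝ → ℝ) : Prop :=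
  ContDiff ℝ ∞ f ∧ ∀ p, HasLineDerivAt ℝ f (g p) p (-2 * u p, 1)

lemma fderiv_apply_material {f : ℝ × ℝ → ℝ} (hf : ContDiff ℝ ∞ f) (p : ℝ × ℝ) (a : ℝ) :
    fderiv ℝ f p (-2 * a, 1) = pdt f p - 2 * a * pdx f p := by
  have hd := hf.differentiable (by simp) p
  have he : ((-2 * a, 1) : ℝ × ℝ) = (0, 1) + (-2 * a) • ((1, 0) : ℝ × ℝ) := by simp
  rw [he, map_add, map_smul, pdt_eq_fderiv hd, pdx_eq_fderiv hd, smul_eq_mul]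
  ring

namespace HasMaterialDeriv

variable {u f g f' g' : ℝ × ℝ → ℝ}

lemma of_pdt (hf : ContDiff ℝ ∞ f) (h : ∀ p, pdt f p = 2 * u p * _root_.pdx f p + g p) :
    HasMaterialDeriv u f g := by
  refine ⟨hf, fun p => ?_⟩
  have hd := (hf.differentiable (by simp) p).hasFDerivAt.hasLineDerivAt (-2 * u p, 1)
  rw [fderiv_apply_material hf, h p] at hd
  simpa using hd

lemma pdt_eq (h : HasMaterialDeriv u f g) (p : ℝ × ℝ) :
    pdt f p = 2 * u p * _root_.pdx f p + g p := by
  have hd := (h.1.differentiable (by simp) p).hasFDerivAt.hasLineDerivAt (-2 * u p, 1)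
  rw [fderiv_apply_material h.1] at hd
  linarith [(h.2 p).unique hd]

lemma congr_deriv (h : HasMaterialDeriv u f g) (hg : ∀ p, g p = g' p) :
    HasMaterialDeriv u f g' :=
  (funext hg : g = g') ▸ h

protected lemma add (hf : HasMaterialDeriv u f f') (hg : HasMaterialDeriv u g g') :
    HasMaterialDeriv u (fun p => f p + g p) (fun p => f' p + g' p) :=
  ⟨hf.1.add hg.1, fun p => HasDerivAt.fun_add (hf.2 p) (hg.2 p)⟩

protected lemma sub (hf : HasMaterialDeriv u f f') (hg : HasMaterialDeriv u g g') :
    HasMaterialDeriv u (fun p => f p - g p) (fun p => f' p - g' p) :=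
  ⟨hf.1.sub hg.1, fun p => HasDerivAt.fun_sub (hf.2 p) (hg.2 p)⟩

protected lemma mul (hf : HasMaterialDeriv u f f') (hg : HasMaterialDeriv u g g') :
    HasMaterialDeriv u (fun p => f p * g p) (fun p => f' p * g p + f p * g' p) :=
  ⟨hf.1.mul hg.1, fun p => by
    have h := HasDerivAt.fun_mul (hf.2 p) (hg.2 p)
    simp only [zero_smul, add_zero] at h
    exact h⟩

protected lemma const_mul (c : ℝ) (hf : HasMaterialDeriv u f f') :
    HasMaterialDeriv u (fun p => c * f p) (fun p => c * f' p) :=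
  ⟨contDiff_const.mul hf.1, fun p => HasDerivAt.const_mul c (hf.2 p)⟩

protected lemma pow (hf : HasMaterialDeriv u f f') (n : ℕ) :
    HasMaterialDeriv u (fun p => f p ^ n) (fun p => n * f p ^ (n - 1) * f' p) :=
  ⟨hf.1.pow n, fun p => by
    have h := HasDerivAt.fun_pow (hf.2 p) n
    simp only [zero_smul, add_zero] at h
    exact h⟩

protected lemma inv (hf : HasMaterialDeriv u f f') (h0 : ∀ p, f p ≠ 0) :
    HasMaterialDeriv u (fun p => (f p)⁻¹) (fun p => -f' p / f p ^ 2) :=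
  ⟨hf.1.inv h0, fun p => by
    have h := HasDerivAt.fun_inv (hf.2 p) (h0 _)
    simp only [zero_smul, add_zero] at h
    exact h⟩

protected lemma pdx (hf : HasMaterialDeriv u f g) (hu : ContDiff ℝ ∞ u) (hg : ContDiff ℝ ∞ g) :
    HasMaterialDeriv u (_root_.pdx f)
      (fun p => 2 * _root_.pdx u p * _root_.pdx f p + _root_.pdx g p) := by
  refine of_pdt hf.1.pdx fun p => ?_
  rw [pdt_pdx_comm hf.1, (funext hf.pdt_eq : pdt f = _)]
  have h := (((hasDerivAt_fst_slice hu p).const_mul 2).mul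
    (hasDerivAt_fst_slice hf.1.pdx p)).add (hasDerivAt_fst_slice hg p)
  refine h.deriv.trans ?_
  ring

lemma inv_mul_pdx {z : ℝ × ℝ → ℝ} {c : ℝ} (hz : HasMaterialDeriv u z fun _ => 0)
    (hu : ContDiff ℝ ∞ u) (hzx : ∀ p, _root_.pdx z p ≠ 0) (hf : HasMaterialDeriv u f fun _ => c) :
    HasMaterialDeriv u (fun p => (_root_.pdx z p)⁻¹ * _root_.pdx f p) fun _ => 0 := by
  refine (((hz.pdx hu contDiff_const).inv hzx).mul (hf.pdx hu contDiff_const)).congr_deriv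
    fun p => ?_
  have h (a : ℝ) : _root_.pdx (fun _ => a) p = 0 := deriv_const _ _
  simp only [h]
  have := hzx p
  field_simp
  ring

lemma iterate {z : ℝ × ℝ → ℝ} {a : ℕ → ℝ × ℝ → ℝ} {m : ℕ}
    (hz : HasMaterialDeriv u z fun _ => 0) (hu : ContDiff ℝ ∞ u)
    (hzx : ∀ p, _root_.pdx z p ≠ 0)
    (hrec : ∀ k, m ≤ k → ∀ p, a (k + 1) p = (_root_.pdx z p)⁻¹ * _root_.pdx (a k) p)
    (hm : HasMaterialDeriv u (a m) fun _ => 0) (k : ℕ) (hk : m ≤ k) :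
    HasMaterialDeriv u (a k) fun _ => 0 := by
  induction k, hk using Nat.le_induction with
  | base => exact hm
  | succ k hk ih =>
    rw [funext (hrec k hk)]
    exact inv_mul_pdx hz hu hzx ih

lemma comp_pi {ι : Type*} [Fintype ι] {G : (ι → ℝ) → ℝ} {Φ : ℝ × ℝ → ι → ℝ}
    (hG : ContDiff ℝ ∞ G) (hΦ : ∀ i, HasMaterialDeriv u (fun p => Φ p i) fun _ => 0) :
    HasMaterialDeriv u (fun p => G (Φ p)) fun _ => 0 := by
  refine ⟨hG.comp (contDiff_pi.2 fun i => (hΦ i).1), fun p => ?_⟩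
  have h : HasDerivAt (fun s : ℝ => Φ (p + s • (-2 * u p, 1))) 0 0 :=
    hasDerivAt_pi.2 fun i => (hΦ i).2 p
  have hGΦ := HasFDerivAt.comp_hasDerivAt (0 : ℝ) (hG.differentiable (by simp) _).hasFDerivAt h
  rw [map_zero] at hGΦ
  exact hGΦ

lemma conservation (hu : ContDiff ℝ ∞ u)
    (hf : HasMaterialDeriv u f fun p => 2 * _root_.pdx u p * f p) (p : ℝ × ℝ) :
    pdt f p = _root_.pdx (fun q => 2 * u q * f q) p := by
  have h := ((hasDerivAt_fst_slice hu p).const_mul 2).mul (hasDerivAt_fst_slice hf.1 p)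
  rw [hf.pdt_eq]
  refine Eq.trans ?_ h.deriv.symm
  ring

end HasMaterialDeriv

theorem riemannN4_conserved_density (u v w z : ℝ × ℝ → ℝ)
    (hu : ContDiff ℝ (⊤ : ℕ∞) u) (hv : ContDiff ℝ (⊤ : ℕ∞) v) (hw : ContDiff ℝ (⊤ : ℕ∞) w)
    (hz : ContDiff ℝ (⊤ : ℕ∞) z)
    (hequ : ∀ p : ℝ × ℝ, pdt u p = 2 * u p * pdx u p - 2 * v p)
    (heqv : ∀ p : ℝ × ℝ, pdt v p = 2 * u p * pdx v p - 2 * w p)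
    (heqw : ∀ p : ℝ × ℝ, pdt w p = 2 * u p * pdx w p - 2 * z p)
    (heqz : ∀ p : ℝ × ℝ, pdt z p = 2 * u p * pdx z p)
    (hzx : ∀ p : ℝ × ℝ, pdx z p ≠ 0)
    (hz0 : ∀ p : ℝ × ℝ, z p ≠ 0)
    (n : ℕ) (hn : 1 ≤ n)
    (G : (Fin (4 * n + 3) → ℝ) → ℝ) (hG : ContDiff ℝ (⊤ : ℕ∞) G)
    (α β γ δ : ℕ → ℝ × ℝ → ℝ)
    (hα1 : ∀ p : ℝ × ℝ,
      α 1 p = ((pdx w p) ^ 2 - 2 * pdx v p * pdx z p) * ((pdx z p) ^ 2)⁻¹)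
    (hβ1 : ∀ p : ℝ × ℝ,
      β 1 p = ((pdx v p) ^ 2 - 2 * pdx u p * pdx w p + 2 * pdx z p) * ((pdx z p) ^ 2)⁻¹)
    (hγ1 : ∀ p : ℝ × ℝ,
      γ 1 p = ((pdx w p) ^ 3 - 3 * pdx z p * pdx v p * pdx w p + 3 * (pdx z p) ^ 2 * pdx u p)
        * ((pdx z p) ^ 3)⁻¹)
    (hδ1 : ∀ p : ℝ × ℝ, δ 1 p = pdx w p * (pdx z p)⁻¹)
    (hαrec : ∀ k, 1 ≤ k → ∀ p : ℝ × ℝ, α (k + 1) p = (pdx z p)⁻¹ * pdx (α k) p)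
    (hβrec : ∀ k, 1 ≤ k → ∀ p : ℝ × ℝ, β (k + 1) p = (pdx z p)⁻¹ * pdx (β k) p)
    (hγrec : ∀ k, 1 ≤ k → ∀ p : ℝ × ℝ, γ (k + 1) p = (pdx z p)⁻¹ * pdx (γ k) p)
    (hδrec : ∀ k, 1 ≤ k → ∀ p : ℝ × ℝ, δ (k + 1) p = (pdx z p)⁻¹ * pdx (δ k) p) :
    ∀ p : ℝ × ℝ,
      pdt (fun q => pdx z q *
      G (fun i =>
        if i.val = 0 then z q
        else if i.val = 1 then (w q) ^ 2 - 2 * v q * z q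
        else if i.val = 2 then
          (3 * u q * (z q) ^ 2 - 3 * v q * w q * z q + (w q) ^ 3) * ((z q) ^ 2)⁻¹
        else if i.val = 6 then δ 1 q - w q * (z q)⁻¹
        else if (i.val - 3) % 4 = 0 then α ((i.val - 3) / 4 + 1) q
        else if (i.val - 3) % 4 = 1 then β ((i.val - 3) / 4 + 1) q
        else if (i.val - 3) % 4 = 2 then γ ((i.val - 3) / 4 + 1) q
        else δ ((i.val - 3) / 4 + 1) q)) p
        = pdx (fun q => 2 * u q * ((fun q => pdx z q *
      G (fun i =>
        if i.val = 0 then z q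
        else if i.val = 1 then (w q) ^ 2 - 2 * v q * z q
        else if i.val = 2 then
          (3 * u q * (z q) ^ 2 - 3 * v q * w q * z q + (w q) ^ 3) * ((z q) ^ 2)⁻¹
        else if i.val = 6 then δ 1 q - w q * (z q)⁻¹
        else if (i.val - 3) % 4 = 0 then α ((i.val - 3) / 4 + 1) q
        else if (i.val - 3) % 4 = 1 then β ((i.val - 3) / 4 + 1) q
        else if (i.val - 3) % 4 = 2 then γ ((i.val - 3) / 4 + 1) q
        else δ ((i.val - 3) / 4 + 1) q)) q)) p := by
  have Dz : HasMaterialDeriv u z fun _ => 0 := .of_pdt hz fun p => by rw [heqz]; ring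
  have Dw : HasMaterialDeriv u w fun p => -2 * z p := .of_pdt hw fun p => by rw [heqw]; ring
  have Dv : HasMaterialDeriv u v fun p => -2 * w p := .of_pdt hv fun p => by rw [heqv]; ring
  have Du : HasMaterialDeriv u u fun p => -2 * v p := .of_pdt hu fun p => by rw [hequ]; ring
  have pdx_const_mul (f : ℝ × ℝ → ℝ) (p : ℝ × ℝ) :
      pdx (fun q => -2 * f q) p = -2 * pdx f p := deriv_const_mul_field _
  have Dzx : HasMaterialDeriv u (pdx z) fun p => 2 * pdx u p * pdx z p :=
    (Dz.pdx hu contDiff_const).congr_deriv fun p => by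
      rw [show pdx (fun _ => (0 : ℝ)) p = 0 from deriv_const _ _, add_zero]
  have Dwx := (Dw.pdx hu (contDiff_const.mul hz)).congr_deriv
    (g' := fun p => 2 * pdx u p * pdx w p - 2 * pdx z p) fun p => by rw [pdx_const_mul]; ring
  have Dvx := (Dv.pdx hu (contDiff_const.mul hw)).congr_deriv
    (g' := fun p => 2 * pdx u p * pdx v p - 2 * pdx w p) fun p => by rw [pdx_const_mul]; ring
  have Dux := (Du.pdx hu (contDiff_const.mul hv)).congr_deriv
    (g' := fun p => 2 * pdx u p * pdx u p - 2 * pdx v p) fun p => by rw [pdx_const_mul]; ring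
  have Dα1 : HasMaterialDeriv u (α 1) fun _ => 0 := by
    rw [funext hα1]
    refine (((Dwx.pow 2).sub ((Dvx.const_mul 2).mul Dzx)).mul
      ((Dzx.pow 2).inv fun p => pow_ne_zero 2 (hzx p))).congr_deriv fun p => ?_
    have := hzx p
    field_simp
    push_cast
    ring
  have Dβ1 : HasMaterialDeriv u (β 1) fun _ => 0 := by
    rw [funext hβ1]
    refine ((((Dvx.pow 2).sub ((Dux.const_mul 2).mul Dwx)).add (Dzx.const_mul 2)).mul
      ((Dzx.pow 2).inv fun p => pow_ne_zero 2 (hzx p))).congr_deriv fun p => ?_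
    have := hzx p
    field_simp
    push_cast
    ring
  have Dγ1 : HasMaterialDeriv u (γ 1) fun _ => 0 := by
    rw [funext hγ1]
    refine ((((Dwx.pow 3).sub (((Dzx.const_mul 3).mul Dvx).mul Dwx)).add
      (((Dzx.pow 2).const_mul 3).mul Dux)).mul
      ((Dzx.pow 3).inv fun p => pow_ne_zero 3 (hzx p))).congr_deriv fun p => ?_
    have := hzx p
    field_simp
    push_cast
    ring
  have Dδ1 : HasMaterialDeriv u (δ 1) fun _ => -2 := by
    rw [funext hδ1]
    refine (Dwx.mul (Dzx.inv hzx)).congr_deriv fun p => ?_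
    have := hzx p
    field_simp
    ring
  have Dδ2 : HasMaterialDeriv u (δ 2) fun _ => 0 := by
    rw [funext (hδrec 1 le_rfl)]
    exact .inv_mul_pdx Dz hu hzx Dδ1
  have Dα := HasMaterialDeriv.iterate Dz hu hzx hαrec Dα1
  have Dβ := HasMaterialDeriv.iterate Dz hu hzx hβrec Dβ1
  have Dγ := HasMaterialDeriv.iterate Dz hu hzx hγrec Dγ1
  have Dδ := HasMaterialDeriv.iterate Dz hu hzx (fun k hk => hδrec k (by omega)) Dδ2
  refine HasMaterialDeriv.conservation hu ((Dzx.mul (.comp_pi hG fun i => ?_)).congr_deriv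
    fun p => by ring)
  split_ifs with h0 h1 h2 h6 hα hβ hγ
  · exact Dz
  · refine ((Dw.pow 2).sub ((Dv.const_mul 2).mul Dz)).congr_deriv fun p => ?_
    push_cast
    ring
  · refine (((((Du.const_mul 3).mul (Dz.pow 2)).sub (((Dv.const_mul 3).mul Dw).mul Dz)).add
      (Dw.pow 3)).mul ((Dz.pow 2).inv fun p => pow_ne_zero 2 (hz0 p))).congr_deriv fun p => ?_
    have := hz0 p
    field_simp
    push_cast
    ring
  · refine (Dδ1.sub (Dw.mul (Dz.inv hz0))).congr_deriv fun p => ?_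
    have := hz0 p
    field_simp
    ring
  · exact Dα _ (by omega)
  · exact Dβ _ (by omega)
  · exact Dγ _ (by omega)
  · exact Dδ _ (by omega)
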